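/- Let L : ℝ^d → ℝ be twice continuously differentiable with Hessian locally Lipschitz near θ̄ (e.g. L is C³), and let u : ℝ^d → ℝ be continuously differentiable with ∇u locally Lipschitz near θ̄. Suppose θ̄ satisfies ∇L(θ̄) = 0 and that H := Hess L(θ̄) is invertible. Fix δ ∈ ℝ and set y := u(θ̄) − δ. Let ε₀ > 0 and let θ : (0, ε₀) → ℝ^d satisfy ∇L(θ(ε)) + ε·(u(θ(ε)) − y)·∇u(θ(ε)) = 0 for all ε ∈ (0, ε₀), with θ(ε) → θ̄ as ε → 0⁺. Then lim_{ε→0⁺} (1/ε²)·(u(θ̄) − u(θ(ε)))² = δ² · ⟨∇u(θ̄), H⁻¹ ∇u(θ̄)⟩². -/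

import Mathlib

open Filter
open scoped RealInnerProductSpace Topology NNReal

/-- The gradient of a `C^(n+1)` function is `C^n`. -/
theorem ContDiff.contDiff_gradient {E : Type*} [NormedAddCommGroup E] [InnerProductSpace ℝ E]
    [CompleteSpace E] {f : E → ℝ} {m n : WithTop ℕ∞} (hf : ContDiff ℝ n f) (hmn : m + 1 ≤ n) :
    ContDiff ℝ m (gradient f) :=
  (InnerProductSpace.toDual ℝ E).symm.contDiff.comp (hf.fderiv_right hmn)

/-- If `f` has an invertible strict derivative `f'` at `a`, then the rescaled increments of a
function `u` along `x → a` are determined by those of `f`. -/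
theorem HasStrictFDerivAt.tendsto_smul_sub_of_tendsto_smul_sub {E F G α : Type*}
    [NormedAddCommGroup E] [NormedSpace ℝ E] [CompleteSpace E]
    [NormedAddCommGroup F] [NormedSpace ℝ F] [NormedAddCommGroup G] [NormedSpace ℝ G]
    {f : E → F} {f' : E ≃L[ℝ] F} {u : E → G} {u' : E →L[ℝ] G} {a : E} {v : F}
    {l : Filter α} {x : α → E} {c : α → ℝ}
    (hf : HasStrictFDerivAt f (f' : E →L[ℝ] F) a) (hu : HasFDerivAt u u' a)
    (hx : Tendsto x l (𝓝 a)) (hc : Tendsto (fun n => c n • (f (x n) - f a)) l (𝓝 v)) :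
    Tendsto (fun n => c n • (u (x n) - u a)) l (𝓝 (u' (f'.symm v))) := by
  have hinv := hf.localInverse_apply_image
  have hcomp : HasFDerivAt (u ∘ hf.localInverse f f' a)
      (u' ∘L (f'.symm : F →L[ℝ] E)) (f a) :=
    HasFDerivAt.comp (f a) (by rwa [hinv]) hf.to_localInverse.hasFDerivAt
  have hd : Tendsto (fun n => f (x n) - f a) l (𝓝 0) := by
    simpa using (hf.continuousAt.tendsto.comp hx).sub_const (f a)
  have hlim := hcomp.hasFDerivWithinAt (s := Set.univ) |>.lim hd (by simp) hc
  refine hlim.congr' ?_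
  filter_upwards [hx.eventually hf.eventually_left_inverse] with n hn
  simp [hn]

/-- **Adversarial data injection (Proposition 3).** Let `L` be `C²` with locally Lipschitz
Hessian near `θ̄`, `u` be `C¹` with locally Lipschitz gradient near `θ̄`, `∇L(θ̄) = 0`, and
the Hessian `H = D(∇L)(θ̄)` invertible. For the target `y = u(θ̄) − δ`, if `θ(ε)` is a
critical point of `L + (ε/2)(u(·) − y)²`, i.e. `∇L(θ(ε)) + ε·(u(θ(ε)) − y)·∇u(θ(ε)) = 0`
on `(0, ε₀)` with `θ(ε) → θ̄` as `ε → 0⁺`, then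
`(1/ε²)·(u(θ̄) − u(θ(ε)))² → δ²·⟨∇u(θ̄), H⁻¹∇u(θ̄)⟩²`. -/
theorem adversarial_data_injection
    {d : ℕ} (L u : EuclideanSpace ℝ (Fin d) → ℝ) (θb : EuclideanSpace ℝ (Fin d))
    (hL : ContDiff ℝ 2 L)
    (hLHessLip : ∃ K : ℝ≥0, ∃ s ∈ 𝓝 θb,
      LipschitzOnWith K (fun θ => fderiv ℝ (gradient L) θ) s)
    (hu : ContDiff ℝ 1 u)
    (huGradLip : ∃ K : ℝ≥0, ∃ s ∈ 𝓝 θb, LipschitzOnWith K (gradient u) s)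
    (hcrit : gradient L θb = 0)
    (H : EuclideanSpace ℝ (Fin d) ≃L[ℝ] EuclideanSpace ℝ (Fin d))
    (hH : (H : EuclideanSpace ℝ (Fin d) →L[ℝ] EuclideanSpace ℝ (Fin d)) =
      fderiv ℝ (gradient L) θb)
    (δ y : ℝ) (hy : y = u θb - δ)
    (ε₀ : ℝ) (hε₀ : 0 < ε₀) (θ : ℝ → EuclideanSpace ℝ (Fin d))
    (hθ : ∀ ε ∈ Set.Ioo 0 ε₀,
      gradient L (θ ε) + (ε * (u (θ ε) - y)) • gradient u (θ ε) = 0)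
    (hconv : Tendsto θ (𝓝[>] 0) (𝓝 θb)) :
    Tendsto (fun ε : ℝ => (1 / ε ^ 2) * (u θb - u (θ ε)) ^ 2) (𝓝[>] 0)
      (𝓝 (δ ^ 2 * ⟪gradient u θb, H.symm (gradient u θb)⟫ ^ 2)) := by
  have hgradL : HasStrictFDerivAt (gradient L)
      (H : EuclideanSpace ℝ (Fin d) →L[ℝ] EuclideanSpace ℝ (Fin d)) θb := by
    rw [hH]
    exact (hL.contDiff_gradient (m := 1) (by norm_num)).contDiffAt.hasStrictFDerivAt one_ne_zero
  have hgradu : Continuous (gradient u) :=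
    (hu.contDiff_gradient (m := 0) (by norm_num)).continuous
  have hu' : HasGradientAt u (gradient u θb) θb :=
    (hu.differentiable one_ne_zero θb).hasGradientAt
  have hgradL_lim : Tendsto (fun ε => ε⁻¹ • (gradient L (θ ε) - gradient L θb)) (𝓝[>] 0)
      (𝓝 (-(δ • gradient u θb))) := by
    have hlim : Tendsto (fun ε => -((u (θ ε) - y) • gradient u (θ ε))) (𝓝[>] 0)
        (𝓝 (-((u θb - y) • gradient u θb))) :=
      ((((hu.continuous.tendsto θb).comp hconv).sub_const y).smul
        ((hgradu.tendsto θb).comp hconv)).neg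
    rw [hy, sub_sub_cancel, ← hy] at hlim
    refine hlim.congr' ?_
    filter_upwards [Ioo_mem_nhdsGT hε₀] with ε hε
    rw [hcrit, sub_zero, eq_neg_of_add_eq_zero_left (hθ ε hε), smul_neg, mul_smul,
      inv_smul_smul₀ hε.1.ne']
  have hlim := (hgradL.tendsto_smul_sub_of_tendsto_smul_sub hu'.hasFDerivAt hconv
    hgradL_lim).pow 2
  convert hlim using 2
  · simp only [smul_eq_mul]
    ring
  · simp
    ring
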